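/- Let Ŝ be a groupwise calibrated soft classifier, D̂ a hard post-processor, and Ŷ = D̂∘Ŝ the composed hard classifier, assumed non-trivial on every group g. For every group g with 0 < BR_g < 1: FPR_{Ŷ,g} = Pr[Ŷ(X_g) = 1] · (1 − E[Ŝ(X_g) | Ŷ(X_g) = 1]) / (1 − E[Ŝ(X_g)]) and FNR_{Ŷ,g} = Pr[Ŷ(X_g) = 0] · E[Ŝ(X_g) | Ŷ(X_g) = 0] / E[Ŝ(X_g)]. -/

import Mathlib

open Finset
open scoped Classical

namespace GroupFairness

noncomputable section

variable {X 𝒢 Ω : Type*} [Fintype X] [Fintype Ω]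

/-- The finset of members of group `g`. -/
def grp (Grp : X → 𝒢) (g : 𝒢) : Finset X :=
  Finset.univ.filter (fun x => Grp x = g)

/-- Expectation of `f x ω` over a uniformly random member `x` of group `g`,
together with internal randomness `ω` distributed according to the weights `w`. -/
def Ex (w : Ω → ℝ) (Grp : X → 𝒢) (g : 𝒢) (f : X → Ω → ℝ) : ℝ :=
  (∑ x ∈ grp Grp g, ∑ ω : Ω, w ω * f x ω) / ((grp Grp g).card : ℝ)

/-- Probability of the event `E x ω` for a uniformly random member of group `g`. -/
def Pr (w : Ω → ℝ) (Grp : X → 𝒢) (g : 𝒢) (E : X → Ω → Prop) : ℝ :=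
  Ex w Grp g (fun x ω => if E x ω then 1 else 0)

/-- Conditional probability of `E` given `F`. -/
def cPr (w : Ω → ℝ) (Grp : X → 𝒢) (g : 𝒢) (E F : X → Ω → Prop) : ℝ :=
  Pr w Grp g (fun x ω => E x ω ∧ F x ω) / Pr w Grp g F

/-- `w` is a probability weighting on the randomness space. -/
def ValidWeights (w : Ω → ℝ) : Prop :=
  (∀ ω, 0 ≤ w ω) ∧ ∑ ω : Ω, w ω = 1

/-- The base rate of group `g`: the probability that a uniformly random member
of `g` has true type `1`. -/
def BaseRate (w : Ω → ℝ) (Grp : X → 𝒢) (Y : X → Bool) (g : 𝒢) : ℝ :=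
  Pr w Grp g (fun x _ => Y x = true)

/-- All scores of the soft classifier lie in `[0,1]`. -/
def IsSoft (S : X → Ω → ℝ) : Prop :=
  ∀ x ω, 0 ≤ S x ω ∧ S x ω ≤ 1

/-- `S` is groupwise calibrated: for every group `g` and score `s` occurring with
positive probability, `Pr[Y = 1 ∣ S = s] = s`. -/
def Calibrated (w : Ω → ℝ) (Grp : X → 𝒢) (Y : X → Bool) (S : X → Ω → ℝ) : Prop :=
  ∀ (g : 𝒢) (s : ℝ), 0 < Pr w Grp g (fun x ω => S x ω = s) →
    cPr w Grp g (fun x _ => Y x = true) (fun x ω => S x ω = s) = s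

/-- The accuracy profile of `S` on group `g`: the pmf of the score `S(X_g)`. -/
def AP (w : Ω → ℝ) (Grp : X → 𝒢) (S : X → Ω → ℝ) (g : 𝒢) (s : ℝ) : ℝ :=
  Pr w Grp g (fun x ω => S x ω = s)

/-- The support of the accuracy profile of `S` on group `g`. -/
def APsupp (w : Ω → ℝ) (Grp : X → 𝒢) (S : X → Ω → ℝ) (g : 𝒢) : Set ℝ :=
  {s | 0 < AP w Grp S g s}

/-- The accuracy profile is *nice*: all groups have the same support. -/
def NiceAP (w : Ω → ℝ) (Grp : X → 𝒢) (S : X → Ω → ℝ) : Prop :=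
  ∀ g g' : 𝒢, APsupp w Grp S g = APsupp w Grp S g'

/-- A (randomized) hard post-processor is described by the probability `q s g` of
outputting `1` on score `s` and group `g`; it is valid if these are probabilities. -/
def ValidPP (q : ℝ → 𝒢 → ℝ) : Prop :=
  ∀ (s : ℝ) (g : 𝒢), 0 ≤ q s g ∧ q s g ≤ 1

/-- Probability that the composed hard classifier `D̂ ∘ Ŝ` outputs `1` on group `g`. -/
def prPos (w : Ω → ℝ) (Grp : X → 𝒢) (S : X → Ω → ℝ) (q : ℝ → 𝒢 → ℝ) (g : 𝒢) : ℝ :=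
  Ex w Grp g (fun x ω => q (S x ω) (Grp x))

/-- Probability that the composed hard classifier `D̂ ∘ Ŝ` outputs `0` on group `g`. -/
def prNeg (w : Ω → ℝ) (Grp : X → 𝒢) (S : X → Ω → ℝ) (q : ℝ → 𝒢 → ℝ) (g : 𝒢) : ℝ :=
  Ex w Grp g (fun x ω => 1 - q (S x ω) (Grp x))

/-- The composed hard classifier is non-trivial on `g`. -/
def NonTrivial (w : Ω → ℝ) (Grp : X → 𝒢) (S : X → Ω → ℝ) (q : ℝ → 𝒢 → ℝ) (g : 𝒢) : Prop :=
  0 < prPos w Grp S q g ∧ 0 < prNeg w Grp S q g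

/-- Positive predictive value `Pr[Y = 1 ∣ Ŷ = 1]` of the composed classifier on `g`. -/
def PPV (w : Ω → ℝ) (Grp : X → 𝒢) (Y : X → Bool) (S : X → Ω → ℝ)
    (q : ℝ → 𝒢 → ℝ) (g : 𝒢) : ℝ :=
  Ex w Grp g (fun x ω => (if Y x then 1 else 0) * q (S x ω) (Grp x)) / prPos w Grp S q g

/-- Negative predictive value `Pr[Y = 0 ∣ Ŷ = 0]` of the composed classifier on `g`. -/
def NPV (w : Ω → ℝ) (Grp : X → 𝒢) (Y : X → Bool) (S : X → Ω → ℝ)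
    (q : ℝ → 𝒢 → ℝ) (g : 𝒢) : ℝ :=
  Ex w Grp g (fun x ω => (if Y x then 0 else 1) * (1 - q (S x ω) (Grp x))) / prNeg w Grp S q g

/-- False positive rate `Pr[Ŷ = 1 ∣ Y = 0]` of the composed classifier on `g`. -/
def FPR (w : Ω → ℝ) (Grp : X → 𝒢) (Y : X → Bool) (S : X → Ω → ℝ)
    (q : ℝ → 𝒢 → ℝ) (g : 𝒢) : ℝ :=
  Ex w Grp g (fun x ω => (if Y x then 0 else 1) * q (S x ω) (Grp x)) /
    Pr w Grp g (fun x _ => Y x = false)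

/-- False negative rate `Pr[Ŷ = 0 ∣ Y = 1]` of the composed classifier on `g`. -/
def FNR (w : Ω → ℝ) (Grp : X → 𝒢) (Y : X → Bool) (S : X → Ω → ℝ)
    (q : ℝ → 𝒢 → ℝ) (g : 𝒢) : ℝ :=
  Ex w Grp g (fun x ω => (if Y x then 1 else 0) * (1 - q (S x ω) (Grp x))) /
    Pr w Grp g (fun x _ => Y x = true)

/-- The threshold post-processor with threshold `τ g` and on-threshold probability
`R g` for group `g`: it outputs `1` with probability `1` above the threshold, `0`
below it, and `1` with probability `R g` at the threshold. -/
def thresholdPP (τ R : 𝒢 → ℝ) : ℝ → 𝒢 → ℝ := fun s g =>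
  if τ g < s then 1 else if s = τ g then R g else 0

theorem Ex_congr {w : Ω → ℝ} {Grp : X → 𝒢} {g : 𝒢} {f h : X → Ω → ℝ}
    (hfh : ∀ x, Grp x = g → ∀ ω, f x ω = h x ω) : Ex w Grp g f = Ex w Grp g h := by
  unfold Ex
  congr 1
  refine Finset.sum_congr rfl fun x hx => Finset.sum_congr rfl fun ω _ => ?_
  rw [hfh x (Finset.mem_filter.1 hx).2 ω]

theorem Ex_sub (w : Ω → ℝ) (Grp : X → 𝒢) (g : 𝒢) (f h : X → Ω → ℝ) :
    Ex w Grp g (fun x ω => f x ω - h x ω) = Ex w Grp g f - Ex w Grp g h := by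
  simp only [Ex, mul_sub, Finset.sum_sub_distrib, sub_div]

theorem Ex_const_mul (w : Ω → ℝ) (Grp : X → 𝒢) (g : 𝒢) (c : ℝ) (f : X → Ω → ℝ) :
    Ex w Grp g (fun x ω => c * f x ω) = c * Ex w Grp g f := by
  simp only [Ex, mul_left_comm _ c, ← Finset.mul_sum, mul_div_assoc]

theorem Ex_sum {ι : Type*} (w : Ω → ℝ) (Grp : X → 𝒢) (g : 𝒢) (t : Finset ι)
    (f : ι → X → Ω → ℝ) :
    Ex w Grp g (fun x ω => ∑ i ∈ t, f i x ω) = ∑ i ∈ t, Ex w Grp g (f i) := by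
  induction t using Finset.induction_on with
  | empty => simp [Ex]
  | insert a t ha ih =>
    rw [Finset.sum_insert ha, ← ih]
    simp only [Ex, Finset.sum_insert ha, mul_add, Finset.sum_add_distrib, add_div]

theorem Ex_one {w : Ω → ℝ} {Grp : X → 𝒢} {g : 𝒢} (hw : ValidWeights w)
    (hne : (grp Grp g).Nonempty) : Ex w Grp g (fun _ _ => 1) = 1 := by
  have hcard : ((grp Grp g).card : ℝ) ≠ 0 := Nat.cast_ne_zero.2 hne.card_pos.ne'
  simp [Ex, hw.2, hcard]

theorem Ex_mono {w : Ω → ℝ} {Grp : X → 𝒢} {g : 𝒢} {f h : X → Ω → ℝ} (hw : ValidWeights w)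
    (hfh : ∀ x ω, f x ω ≤ h x ω) : Ex w Grp g f ≤ Ex w Grp g h :=
  div_le_div_of_nonneg_right
    (Finset.sum_le_sum fun x _ => Finset.sum_le_sum fun ω _ =>
      mul_le_mul_of_nonneg_left (hfh x ω) (hw.1 ω))
    (Nat.cast_nonneg _)

theorem Pr_eq_Ex (w : Ω → ℝ) (Grp : X → 𝒢) (g : 𝒢) (E : X → Ω → Prop)
    [∀ x ω, Decidable (E x ω)] :
    Pr w Grp g E = Ex w Grp g (fun x ω => if E x ω then 1 else 0) :=
  Ex_congr fun x _ ω => by congr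

theorem Pr_nonneg {w : Ω → ℝ} (Grp : X → 𝒢) (g : 𝒢) (E : X → Ω → Prop)
    (hw : ValidWeights w) : 0 ≤ Pr w Grp g E := by
  have h : Ex w Grp g (fun _ _ => 0) ≤ Pr w Grp g E :=
    Ex_mono hw fun x ω => by split_ifs <;> norm_num
  simpa [Ex] using h

theorem Pr_mono {w : Ω → ℝ} {Grp : X → 𝒢} {g : 𝒢} {E F : X → Ω → Prop} (hw : ValidWeights w)
    (hEF : ∀ x ω, E x ω → F x ω) : Pr w Grp g E ≤ Pr w Grp g F :=
  Ex_mono hw fun x ω => by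
    by_cases hE : E x ω
    · simp [hE, hEF x ω hE]
    · by_cases hF : F x ω <;> simp [hE, hF]

/-- Calibration without the positivity condition: `Pr[Y = 1, S = s] = s · Pr[S = s]`. -/
theorem Calibrated.Pr_and_eq {w : Ω → ℝ} {Grp : X → 𝒢} {Y : X → Bool} {S : X → Ω → ℝ}
    (hcal : Calibrated w Grp Y S) (hw : ValidWeights w) (g : 𝒢) (s : ℝ) :
    Pr w Grp g (fun x ω => Y x = true ∧ S x ω = s) = s * Pr w Grp g (fun x ω => S x ω = s) := by
  rcases (Pr_nonneg Grp g (fun x ω => S x ω = s) hw).eq_or_lt with h0 | hpos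
  · rw [← h0, mul_zero]
    refine le_antisymm ?_ (Pr_nonneg _ _ _ hw)
    rw [h0]
    exact Pr_mono hw fun _ _ h => h.2
  · exact (div_eq_iff hpos.ne').1 (hcal g s hpos)

/-- Under calibration, `Y` and `S` have the same correlation with any function of the score. -/
theorem Calibrated.Ex_type_mul_eq {w : Ω → ℝ} {Grp : X → 𝒢} {Y : X → Bool} {S : X → Ω → ℝ}
    (hcal : Calibrated w Grp Y S) (hw : ValidWeights w) (g : 𝒢) (f : ℝ → 𝒢 → ℝ) :
    Ex w Grp g (fun x ω => (if Y x then 1 else 0) * f (S x ω) (Grp x)) =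
      Ex w Grp g (fun x ω => S x ω * f (S x ω) (Grp x)) := by
  set t : Finset ℝ := Finset.univ.image fun p : X × Ω => S p.1 p.2
  have hmem : ∀ x ω, S x ω ∈ t := fun x ω =>
    Finset.mem_image_of_mem (fun p : X × Ω => S p.1 p.2) (Finset.mem_univ (x, ω))
  calc
    _ = Ex w Grp g (fun x ω => ∑ s ∈ t, f s g * if Y x = true ∧ S x ω = s then 1 else 0) :=
      Ex_congr fun x hx ω => by
        cases Y x <;> simp [hmem, hx]
    _ = ∑ s ∈ t, f s g * Pr w Grp g (fun x ω => Y x = true ∧ S x ω = s) := by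
      rw [Ex_sum]
      exact Finset.sum_congr rfl fun s _ => by rw [Ex_const_mul, Pr_eq_Ex]
    _ = ∑ s ∈ t, f s g * s * Pr w Grp g (fun x ω => S x ω = s) :=
      Finset.sum_congr rfl fun s _ => by rw [hcal.Pr_and_eq hw, mul_assoc]
    _ = Ex w Grp g (fun x ω => ∑ s ∈ t, f s g * s * if S x ω = s then 1 else 0) := by
      rw [Ex_sum]
      exact Finset.sum_congr rfl fun s _ => by rw [Ex_const_mul, Pr_eq_Ex]
    _ = _ := Ex_congr fun x hx ω => by simp [hmem, hx, mul_comm]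

theorem Calibrated.baseRate_eq {w : Ω → ℝ} {Grp : X → 𝒢} {Y : X → Bool} {S : X → Ω → ℝ}
    (hcal : Calibrated w Grp Y S) (hw : ValidWeights w) (g : 𝒢) :
    Pr w Grp g (fun x _ => Y x = true) = Ex w Grp g (fun x ω => S x ω) := by
  simpa [Pr_eq_Ex] using hcal.Ex_type_mul_eq hw g fun _ _ => 1

theorem Pr_type_false {w : Ω → ℝ} {Grp : X → 𝒢} (Y : X → Bool) {g : 𝒢} (hw : ValidWeights w)
    (hne : (grp Grp g).Nonempty) :
    Pr w Grp g (fun x _ => Y x = false) = 1 - Pr w Grp g (fun x _ => Y x = true) := by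
  have h := Ex_sub w Grp g (fun _ _ => 1) (fun x _ => if Y x = true then 1 else 0)
  rw [Ex_one hw hne] at h
  rw [Pr_eq_Ex, Pr_eq_Ex, ← h]
  exact Ex_congr fun x _ ω => by cases Y x <;> simp

/-- For a groupwise calibrated soft classifier post-processed by a
hard post-processor into a classifier non-trivial on every group, and any group `g`
with `0 < BR_g < 1`:
`FPR_g = Pr[Ŷ = 1] · (1 − E[Ŝ ∣ Ŷ = 1]) / (1 − E[Ŝ])` and
`FNR_g = Pr[Ŷ = 0] · E[Ŝ ∣ Ŷ = 0] / E[Ŝ]`. -/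
theorem FPR_FNR_as_conditional_expectations
    (w : Ω → ℝ) (Grp : X → 𝒢) (Y : X → Bool) (S : X → Ω → ℝ) (q : ℝ → 𝒢 → ℝ)
    (hw : ValidWeights w) (hne : ∀ g : 𝒢, (grp Grp g).Nonempty)
    (hS : IsSoft S) (hcal : Calibrated w Grp Y S) (hq : ValidPP q)
    (hnt : ∀ g : 𝒢, NonTrivial w Grp S q g) (g : 𝒢)
    (hBR0 : 0 < BaseRate w Grp Y g) (hBR1 : BaseRate w Grp Y g < 1) :
    FPR w Grp Y S q g =
        prPos w Grp S q g *
          (1 - Ex w Grp g (fun x ω => S x ω * q (S x ω) (Grp x)) / prPos w Grp S q g) /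
            (1 - Ex w Grp g (fun x ω => S x ω)) ∧
      FNR w Grp Y S q g =
        prNeg w Grp S q g *
          (Ex w Grp g (fun x ω => S x ω * (1 - q (S x ω) (Grp x))) / prNeg w Grp S q g) /
            Ex w Grp g (fun x ω => S x ω) := by
  have hpos := (hnt g).1.ne'
  have hneg := (hnt g).2.ne'
  have hq_pos := hcal.Ex_type_mul_eq hw g q
  have hq_neg := hcal.Ex_type_mul_eq hw g fun s h => 1 - q s h
  constructor
  · have hnum : Ex w Grp g (fun x ω => (if Y x then 0 else 1) * q (S x ω) (Grp x)) =
        prPos w Grp S q g - Ex w Grp g (fun x ω => S x ω * q (S x ω) (Grp x)) := by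
      rw [← hq_pos, prPos, ← Ex_sub]
      exact Ex_congr fun x _ ω => by cases Y x <;> simp
    rw [FPR, hnum, Pr_type_false Y hw (hne g), hcal.baseRate_eq hw, mul_sub, mul_one,
      mul_div_cancel₀ _ hpos]
  · rw [FNR, hq_neg, hcal.baseRate_eq hw, mul_div_cancel₀ _ hneg]

end

end GroupFairness
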